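/- arXiv:1902.03513 — 8 statements merged into one kernel-verified Lean document; each statement's English description precedes it below -/
import Mathlib

section
/- Let Ω be a nonempty set and 𝒢 ⊆ 𝓛 a set of gambles. The following are equivalent: (1) the natural extension N(𝒢) is coherent, i.e. N(𝒢) ∩ 𝓛< = ∅; (2) posi(𝒢) ∩ 𝓛< = ∅; (3) the constant gamble −𝟙 does not belong to posi(𝒢 ∪ 𝓛≥); (4) there exists a gamble g ∈ 𝓛 with g ∉ N(𝒢). -/
open BoundedContinuousFunction

noncomputable section

/-- The set of nonnegative gambles `𝓛≥`. -/
def Lnn (Ω : Type*) [TopologicalSpace Ω] : Set (Ω →ᵇ ℝ) := {g | ∀ ω, 0 ≤ g ω}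

/-- The set of negative gambles `𝓛<` (supremum strictly negative). -/
def Lneg (Ω : Type*) [TopologicalSpace Ω] : Set (Ω →ᵇ ℝ) := {g | (⨆ ω, g ω) < 0}

/-- `posi 𝒢`: all finite nonnegative linear combinations of elements of `𝒢`. -/
def posi {Ω : Type*} [TopologicalSpace Ω] (𝒢 : Set (Ω →ᵇ ℝ)) : Set (Ω →ᵇ ℝ) :=
  {h | ∃ (ℓ : ℕ) (lam : Fin ℓ → ℝ) (gs : Fin ℓ → Ω →ᵇ ℝ),
    (∀ i, 0 ≤ lam i) ∧ (∀ i, gs i ∈ 𝒢) ∧ h = ∑ i, lam i • gs i}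

/-- The natural extension `N(𝒢) = cl (posi (𝓛≥ ∪ 𝒢))` (sup-norm closure). -/
def natExt {Ω : Type*} [TopologicalSpace Ω] (𝒢 : Set (Ω →ᵇ ℝ)) : Set (Ω →ᵇ ℝ) :=
  closure (posi (Lnn Ω ∪ 𝒢))

open scoped NNReal

theorem posi_eq_span {Ω : Type*} [TopologicalSpace Ω] (𝒢 : Set (Ω →ᵇ ℝ)) :
    posi 𝒢 = (Submodule.span ℝ≥0 𝒢 : Set (Ω →ᵇ ℝ)) := by
  ext h
  rw [SetLike.mem_coe, Submodule.mem_span_set']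
  constructor
  · rintro ⟨n, c, gs, hc, hgs, rfl⟩
    exact ⟨n, fun i => ⟨c i, hc i⟩, fun i => ⟨gs i, hgs i⟩, rfl⟩
  · rintro ⟨n, c, gs, rfl⟩
    exact ⟨n, fun i => c i, fun i => gs i, fun i => (c i).2, fun i => (gs i).2, rfl⟩

theorem mem_Lneg_iff {Ω : Type*} [Nonempty Ω] [TopologicalSpace Ω] {g : Ω →ᵇ ℝ} :
    g ∈ Lneg Ω ↔ ∃ δ > 0, ∀ ω, g ω ≤ -δ := by
  constructor
  · intro h
    exact ⟨-(⨆ ω, g ω), neg_pos.2 h, fun ω => by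
      simpa using le_ciSup g.isBounded_range.bddAbove ω⟩
  · rintro ⟨δ, hδ, h⟩
    exact (ciSup_le h).trans_lt (neg_lt_zero.2 hδ)

theorem nonneg_of_mem_span_Lnn {Ω : Type*} [TopologicalSpace Ω] {g : Ω →ᵇ ℝ}
    (hg : g ∈ Submodule.span ℝ≥0 (Lnn Ω)) (ω : Ω) : 0 ≤ g ω := by
  induction hg using Submodule.span_induction with
  | mem x hx => exact hx ω
  | zero => simp
  | add x y _ _ hx hy => exact add_nonneg hx hy
  | smul c x _ hx => exact mul_nonneg c.2 hx

/-- A convex cone containing `𝓛≥` is upward closed. -/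
theorem mem_span_of_le {Ω : Type*} [TopologicalSpace Ω] {𝒢 : Set (Ω →ᵇ ℝ)} {f g : Ω →ᵇ ℝ}
    (hf : f ∈ Submodule.span ℝ≥0 (𝒢 ∪ Lnn Ω)) (hfg : ∀ ω, f ω ≤ g ω) :
    g ∈ Submodule.span ℝ≥0 (𝒢 ∪ Lnn Ω) := by
  have h : g - f ∈ Submodule.span ℝ≥0 (𝒢 ∪ Lnn Ω) :=
    Submodule.subset_span (Or.inr fun ω => sub_nonneg.2 (hfg ω))
  simpa using Submodule.add_mem _ hf h

theorem neg_one_notMem_posi {Ω : Type*} [Nonempty Ω] [TopologicalSpace Ω] {𝒢 : Set (Ω →ᵇ ℝ)}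
    (h : posi 𝒢 ∩ Lneg Ω = ∅) :
    -(BoundedContinuousFunction.const Ω (1 : ℝ)) ∉ posi (𝒢 ∪ Lnn Ω) := by
  intro hmem
  rw [posi_eq_span, SetLike.mem_coe, Submodule.span_union, Submodule.mem_sup] at hmem
  obtain ⟨a, ha, b, hb, hab⟩ := hmem
  refine Set.eq_empty_iff_forall_notMem.1 h a
    ⟨by rwa [posi_eq_span], mem_Lneg_iff.2 ⟨1, one_pos, fun ω => ?_⟩⟩
  have h1 : a ω + b ω = -1 := by simpa using DFunLike.congr_fun hab ω
  linarith [nonneg_of_mem_span_Lnn hb ω]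

theorem natExt_inter_Lneg_eq_empty {Ω : Type*} [Nonempty Ω] [TopologicalSpace Ω]
    {𝒢 : Set (Ω →ᵇ ℝ)}
    (h : -(BoundedContinuousFunction.const Ω (1 : ℝ)) ∉ posi (𝒢 ∪ Lnn Ω)) :
    natExt 𝒢 ∩ Lneg Ω = ∅ := by
  refine Set.eq_empty_iff_forall_notMem.2 ?_
  rintro f ⟨hf, hneg⟩
  obtain ⟨δ, hδ, hfδ⟩ := mem_Lneg_iff.1 hneg
  obtain ⟨g, hg, hfg⟩ := Metric.mem_closure_iff.1 hf (δ / 2) (half_pos hδ)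
  rw [posi_eq_span, SetLike.mem_coe, Set.union_comm] at hg
  rw [posi_eq_span, SetLike.mem_coe] at h
  have hc : 0 ≤ (δ / 2)⁻¹ := by positivity
  refine h (mem_span_of_le (Submodule.smul_mem _ (⟨(δ / 2)⁻¹, hc⟩ : ℝ≥0) hg) fun ω => ?_)
  have hd := (abs_lt.1 ((Real.dist_eq _ _).symm.trans_lt
    ((BoundedContinuousFunction.dist_coe_le_dist ω).trans_lt hfg))).1
  have hgω : g ω ≤ -(δ / 2) := by linarith [hfδ ω]
  calc (δ / 2)⁻¹ * g ω ≤ (δ / 2)⁻¹ * -(δ / 2) := mul_le_mul_of_nonneg_left hgω hc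
    _ = -1 := by field_simp

theorem natExt_eq_univ {Ω : Type*} [TopologicalSpace Ω] {𝒢 : Set (Ω →ᵇ ℝ)}
    (h : -(BoundedContinuousFunction.const Ω (1 : ℝ)) ∈ posi (𝒢 ∪ Lnn Ω)) :
    natExt 𝒢 = Set.univ := by
  refine Set.eq_univ_of_forall fun g => subset_closure ?_
  rw [posi_eq_span, SetLike.mem_coe] at h
  rw [posi_eq_span, SetLike.mem_coe, Set.union_comm]
  refine mem_span_of_le (Submodule.smul_mem _ ‖g‖₊ h) fun ω => ?_
  calc ‖g‖ * -1 = -‖g‖ := by ring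
    _ ≤ g ω := (abs_le.1 (g.norm_coe_le_norm ω)).1

/-- for a nonempty `Ω` and a set of gambles `𝒢`, the following are
equivalent: (1) `N(𝒢)` is coherent, i.e. `N(𝒢) ∩ 𝓛< = ∅`; (2) `posi 𝒢 ∩ 𝓛< = ∅`;
(3) `-𝟙 ∉ posi (𝒢 ∪ 𝓛≥)`; (4) some gamble is not in `N(𝒢)`. -/
theorem stmt0 {Ω : Type*} [Nonempty Ω] [TopologicalSpace Ω] [DiscreteTopology Ω]
    (𝒢 : Set (Ω →ᵇ ℝ)) :
    (natExt 𝒢 ∩ Lneg Ω = ∅ ↔ posi 𝒢 ∩ Lneg Ω = ∅)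
    ∧ (natExt 𝒢 ∩ Lneg Ω = ∅ ↔
        -(BoundedContinuousFunction.const Ω (1 : ℝ)) ∉ posi (𝒢 ∪ Lnn Ω))
    ∧ (natExt 𝒢 ∩ Lneg Ω = ∅ ↔ ∃ g : Ω →ᵇ ℝ, g ∉ natExt 𝒢) := by
  have h12 : natExt 𝒢 ∩ Lneg Ω = ∅ → posi 𝒢 ∩ Lneg Ω = ∅ := fun h =>
    Set.subset_empty_iff.1 <| h ▸ Set.inter_subset_inter_left _ (by
      refine subset_trans ?_ subset_closure
      rw [posi_eq_span, posi_eq_span]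
      exact Submodule.span_mono Set.subset_union_right)
  refine ⟨⟨h12, fun h => natExt_inter_Lneg_eq_empty (neg_one_notMem_posi h)⟩,
    ⟨fun h => neg_one_notMem_posi (h12 h), natExt_inter_Lneg_eq_empty⟩,
    fun h => ⟨-(BoundedContinuousFunction.const Ω (1 : ℝ)), fun hmem => ?_⟩, ?_⟩
  · exact Set.eq_empty_iff_forall_notMem.1 h _
      ⟨hmem, mem_Lneg_iff.2 ⟨1, one_pos, fun ω => le_rfl⟩⟩
  · rintro ⟨g, hg⟩
    exact natExt_inter_Lneg_eq_empty fun h => hg (natExt_eq_univ h ▸ Set.mem_univ g)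
end
end

section
/- Let K be a closed convex cone in 𝓛. The following are equivalent: (1) 𝓛≥ ⊆ K and K ∩ 𝓛< = ∅; (2) 𝓛≥ ⊆ K and K ≠ 𝓛; (3) every continuous linear functional L on 𝓛 with L(g) ≥ 0 for all g ∈ K satisfies L(h) ≥ 0 for all h ∈ 𝓛≥ (i.e. K• consists of positive functionals), and K• ≠ {0}. -/
open BoundedContinuousFunction

noncomputable section

/-- The dual `K•` of a set of gambles: all continuous linear functionals that are
nonnegative on `K`. -/
def dualSet {Ω : Type*} [TopologicalSpace Ω] (K : Set (Ω →ᵇ ℝ)) :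
    Set ((Ω →ᵇ ℝ) →L[ℝ] ℝ) :=
  {L | ∀ g ∈ K, 0 ≤ L g}

/-- Functionals separating a point from a nonempty closed convex set stable under positive
scaling can be chosen nonnegative on the set and negative at the point. -/
theorem exists_mem_dualSet_apply_neg {Ω : Type*} [TopologicalSpace Ω] {K : Set (Ω →ᵇ ℝ)}
    (hK : IsClosed K) (hconv : Convex ℝ K) (hcone : ∀ c : ℝ, 0 < c → ∀ g ∈ K, c • g ∈ K)
    (hne : K.Nonempty) {x : Ω →ᵇ ℝ} (hx : x ∉ K) : ∃ L ∈ dualSet K, L x < 0 := by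
  obtain ⟨L, u, hxu, hu⟩ := geometric_hahn_banach_point_closed hconv hK hx
  have hscale : ∀ g ∈ K, ∀ c : ℝ, 0 < c → u < c * L g := fun g hg c hc => by
    simpa using hu _ (hcone c hc g hg)
  refine ⟨L, fun g hg => ?_, ?_⟩
  · by_contra! hneg
    have h := hscale g hg ((|u| + 1) / (-L g)) (div_pos (by positivity) (by linarith))
    have e : (|u| + 1) / (-L g) * L g = -(|u| + 1) := by field_simp [hneg.ne]
    rw [e] at h
    linarith [neg_abs_le u]
  · obtain ⟨g, hg⟩ := hne
    refine hxu.trans_le ?_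
    by_contra! hpos
    have h := hscale g hg (u / (|L g| + 1)) (by positivity)
    rw [div_mul_eq_mul_div, lt_div_iff₀ (by positivity)] at h
    nlinarith [le_abs_self (L g)]

/-- A convex set stable under positive scaling is stable under addition. -/
theorem add_mem_of_convex_of_smul_mem {E : Type*} [AddCommGroup E] [Module ℝ E] {K : Set E}
    (hconv : Convex ℝ K) (hcone : ∀ c : ℝ, 0 < c → ∀ g ∈ K, c • g ∈ K) {f g : E}
    (hf : f ∈ K) (hg : g ∈ K) : f + g ∈ K := by
  have h := hcone 2 two_pos _
    (hconv hf hg (by norm_num : (0 : ℝ) ≤ 1 / 2) (by norm_num : (0 : ℝ) ≤ 1 / 2) (by norm_num))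
  rwa [← smul_add, smul_smul, show (2 : ℝ) * (1 / 2) = 1 by norm_num, one_smul] at h

/-- A convex cone containing the nonnegative gambles and a negative one contains everything. -/
theorem eq_univ_of_mem_Lneg {Ω : Type*} [TopologicalSpace Ω] {K : Set (Ω →ᵇ ℝ)}
    (hconv : Convex ℝ K) (hcone : ∀ c : ℝ, 0 < c → ∀ g ∈ K, c • g ∈ K) (hpos : Lnn Ω ⊆ K)
    {g : Ω →ᵇ ℝ} (hgK : g ∈ K) (hg : g ∈ Lneg Ω) : K = Set.univ := by
  have hs : (⨆ ω, g ω) < 0 := hg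
  refine Set.eq_univ_of_forall fun f => ?_
  set c : ℝ := (‖f‖ + 1) / (-⨆ ω, g ω) with hc
  have hc0 : 0 < c := div_pos (by positivity) (by linarith)
  have hcs : c * (⨆ ω, g ω) = -(‖f‖ + 1) := by
    rw [hc]
    field_simp [hs.ne]
  have hmem : f - c • g ∈ Lnn Ω := fun ω => by
    have h1 : g ω ≤ ⨆ ω, g ω := le_ciSup g.isBounded_range.bddAbove ω
    have h2 := mul_le_mul_of_nonneg_left h1 hc0.le
    have h3 := (abs_le.mp (f.norm_coe_le_norm ω)).1
    simp only [BoundedContinuousFunction.coe_sub, BoundedContinuousFunction.coe_smul,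
      Pi.sub_apply, smul_eq_mul]
    linarith
  simpa using add_mem_of_convex_of_smul_mem hconv hcone (hpos hmem) (hcone c hc0 g hgK)

/-- for a closed convex cone `K` in `𝓛`, the following are equivalent:
(1) `𝓛≥ ⊆ K` and `K ∩ 𝓛< = ∅`; (2) `𝓛≥ ⊆ K` and `K ≠ 𝓛`;
(3) every element of `K•` is nonnegative on `𝓛≥`, and `K• ≠ {0}`. -/
theorem stmt1 {Ω : Type*} [Nonempty Ω] [TopologicalSpace Ω] [DiscreteTopology Ω]
    (K : Set (Ω →ᵇ ℝ)) (hK : IsClosed K) (hconv : Convex ℝ K)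
    (hcone : ∀ c : ℝ, 0 < c → ∀ g ∈ K, c • g ∈ K) :
    ((Lnn Ω ⊆ K ∧ K ∩ Lneg Ω = ∅) ↔ (Lnn Ω ⊆ K ∧ K ≠ Set.univ))
    ∧ ((Lnn Ω ⊆ K ∧ K ∩ Lneg Ω = ∅) ↔
        ((∀ L ∈ dualSet K, ∀ h ∈ Lnn Ω, 0 ≤ L h) ∧ dualSet K ≠ {0})) := by
  have h12 : (Lnn Ω ⊆ K ∧ K ∩ Lneg Ω = ∅) ↔ (Lnn Ω ⊆ K ∧ K ≠ Set.univ) := by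
    refine and_congr_right fun hpos => ⟨?_, fun hne => ?_⟩
    · rintro h rfl
      have hmem : (-1 : Ω →ᵇ ℝ) ∈ Set.univ ∩ Lneg Ω := ⟨trivial, by simp [Lneg]⟩
      simp [h] at hmem
    · rw [Set.eq_empty_iff_forall_notMem]
      exact fun g hg => hne (eq_univ_of_mem_Lneg hconv hcone hpos hg.1 hg.2)
  refine ⟨h12, h12.trans ⟨fun ⟨hpos, hne⟩ => ⟨fun L hL h hh => hL h (hpos hh), fun h0 => ?_⟩,
    fun ⟨hdual, hne⟩ => ?_⟩⟩
  · obtain ⟨x, hx⟩ := (Set.ne_univ_iff_exists_notMem K).mp hne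
    obtain ⟨L, hL, hLx⟩ := exists_mem_dualSet_apply_neg hK hconv hcone
      ⟨0, hpos fun _ => le_rfl⟩ hx
    rw [h0, Set.mem_singleton_iff] at hL
    simp [hL] at hLx
  · have hKne : K.Nonempty := by
      rw [Set.nonempty_iff_ne_empty]
      rintro rfl
      obtain ⟨ω⟩ := ‹Nonempty Ω›
      have h := hdual (-BoundedContinuousFunction.evalCLM ℝ ω) (by simp [dualSet]) 1
        (fun _ => zero_le_one)
      norm_num at h
    refine ⟨fun h hh => ?_, ?_⟩
    · by_contra hhK
      obtain ⟨L, hL, hLh⟩ := exists_mem_dualSet_apply_neg hK hconv hcone hKne hhK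
      exact hLh.not_ge (hdual L hL h hh)
    · rintro rfl
      refine hne (Set.eq_singleton_iff_unique_mem.mpr ⟨fun _ _ => le_rfl, fun L hL => ?_⟩)
      ext g
      have h1 := hL g trivial
      have h2 := hL (-g) trivial
      rw [map_neg] at h2
      simpa using le_antisymm (by linarith) h1
end
end

section
/- The map K ↦ K• ∩ 𝒮 is a bijection between the family of coherent sets of desirable gambles (closed convex cones K ⊆ 𝓛 with 𝓛≥ ⊆ K and K ∩ 𝓛< = ∅) and the family of nonempty weak*-closed convex subsets of the set 𝒮 of states on 𝓛; its inverse sends a nonempty weak*-closed convex set 𝒫 ⊆ 𝒮 to the cone {g ∈ 𝓛 : L(g) ≥ 0 for all L ∈ 𝒫}. -/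
open BoundedContinuousFunction

noncomputable section

/-- A coherent set of desirable gambles: a closed convex cone containing `𝓛≥`
and avoiding `𝓛<`. -/
def IsCoherent {Ω : Type*} [TopologicalSpace Ω] (K : Set (Ω →ᵇ ℝ)) : Prop :=
  IsClosed K ∧ Convex ℝ K ∧ (∀ c : ℝ, 0 < c → ∀ g ∈ K, c • g ∈ K) ∧
    Lnn Ω ⊆ K ∧ K ∩ Lneg Ω = ∅

/-- A state: a (weak*-)continuous linear functional that is nonnegative on `𝓛≥`
and preserves the constant gamble `𝟙`. -/
def IsState {Ω : Type*} [TopologicalSpace Ω] (L : WeakDual ℝ (Ω →ᵇ ℝ)) : Prop :=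
  (∀ g : Ω →ᵇ ℝ, (∀ ω, 0 ≤ g ω) → 0 ≤ L g) ∧
    L (BoundedContinuousFunction.const Ω (1 : ℝ)) = 1

/-- The set `𝒮` of all states. -/
def states (Ω : Type*) [TopologicalSpace Ω] : Set (WeakDual ℝ (Ω →ᵇ ℝ)) :=
  {L | IsState L}

/-- The forward map `K ↦ K• ∩ 𝒮`. -/
def dualStates {Ω : Type*} [TopologicalSpace Ω] (K : Set (Ω →ᵇ ℝ)) :
    Set (WeakDual ℝ (Ω →ᵇ ℝ)) :=
  {L | IsState L ∧ ∀ g ∈ K, 0 ≤ L g}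

/-- The inverse map `P ↦ {g : L(g) ≥ 0 for all L ∈ P}`. -/
def coneOf {Ω : Type*} [TopologicalSpace Ω] (P : Set (WeakDual ℝ (Ω →ᵇ ℝ))) :
    Set (Ω →ᵇ ℝ) :=
  {g | ∀ L ∈ P, 0 ≤ L g}

theorem exists_mem_dualStates_neg {Ω : Type*} [TopologicalSpace Ω] {K : Set (Ω →ᵇ ℝ)}
    (hK : IsCoherent K) {g : Ω →ᵇ ℝ} (hg : g ∉ K) : ∃ L ∈ dualStates K, L g < 0 := by
  obtain ⟨hcl, hconv, hcone, hnn, -⟩ := hK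
  obtain ⟨f, u, hfg, hfK⟩ := geometric_hahn_banach_point_closed hconv hcl hg
  have hu : u < 0 := by simpa using hfK 0 (hnn fun ω => le_rfl)
  have hpos : ∀ h ∈ K, 0 ≤ f h := by
    intro h hh
    by_contra! hneg
    have h1 := hfK _ (hcone (u / f h) (div_pos_of_neg_of_neg hu hneg) h hh)
    rw [map_smul, smul_eq_mul, div_mul_cancel₀ _ hneg.ne] at h1
    exact lt_irrefl _ h1
  have h1 : 0 < f (BoundedContinuousFunction.const Ω (1 : ℝ)) := by
    refine lt_of_le_of_ne (hpos _ (hnn fun ω => zero_le_one)) fun h0 => ?_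
    have h2 := hpos (g + ‖g‖ • BoundedContinuousFunction.const Ω (1 : ℝ)) (hnn fun ω => by
      have := (abs_le.1 (g.norm_coe_le_norm ω)).1
      simp only [coe_add, coe_smul, Pi.add_apply, const_apply, smul_eq_mul]
      linarith)
    rw [map_add, map_smul, ← h0, smul_zero] at h2
    linarith
  refine ⟨StrongDual.toWeakDual ((f (BoundedContinuousFunction.const Ω (1 : ℝ)))⁻¹ • f),
    ⟨⟨fun h hh => ?_, ?_⟩, fun h hh => ?_⟩, ?_⟩
  · exact mul_nonneg (inv_nonneg.2 h1.le) (hpos h (hnn hh))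
  · exact inv_mul_cancel₀ h1.ne'
  · exact mul_nonneg (inv_nonneg.2 h1.le) (hpos h hh)
  · exact mul_neg_of_pos_of_neg (inv_pos.2 h1) (hfg.trans hu)

theorem IsState.apply_neg {Ω : Type*} [TopologicalSpace Ω] {L : WeakDual ℝ (Ω →ᵇ ℝ)}
    (hL : IsState L) {g : Ω →ᵇ ℝ} (hg : g ∈ Lneg Ω) : L g < 0 := by
  have h := hL.1 ((⨆ ω, g ω) • BoundedContinuousFunction.const Ω (1 : ℝ) - g) fun ω => by
    have := le_ciSup (f := fun ω => g ω) g.isBounded_range.bddAbove ω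
    simp only [coe_sub, coe_smul, Pi.sub_apply, const_apply, smul_eq_mul]
    linarith
  rw [map_sub, map_smul, hL.2, smul_eq_mul, mul_one] at h
  exact (sub_nonneg.1 h).trans_lt hg

theorem isClosed_dualStates {Ω : Type*} [TopologicalSpace Ω] (K : Set (Ω →ᵇ ℝ)) :
    IsClosed (dualStates K) := by
  have h : ∀ g : Ω →ᵇ ℝ, IsClosed {L : WeakDual ℝ (Ω →ᵇ ℝ) | 0 ≤ L g} := fun g =>
    isClosed_le continuous_const (WeakDual.eval_continuous g)
  simp only [dualStates, IsState, Set.ofPred_and, Set.ofPred_forall]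
  exact ((isClosed_iInter fun g => isClosed_iInter fun _ => h g).inter
    (isClosed_eq (WeakDual.eval_continuous _) continuous_const)).inter
    (isClosed_iInter fun g => isClosed_iInter fun _ => h g)

theorem convex_dualStates {Ω : Type*} [TopologicalSpace Ω] (K : Set (Ω →ᵇ ℝ)) :
    Convex ℝ (dualStates K) := by
  rintro L ⟨⟨hL, hL1⟩, hLK⟩ M ⟨⟨hM, hM1⟩, hMK⟩ a b ha hb hab
  refine ⟨⟨fun g hg => ?_, ?_⟩, fun g hg => ?_⟩
  · exact add_nonneg (mul_nonneg ha (hL g hg)) (mul_nonneg hb (hM g hg))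
  · change a * L _ + b * M _ = 1
    rw [hL1, hM1, mul_one, mul_one, hab]
  · exact add_nonneg (mul_nonneg ha (hLK g hg)) (mul_nonneg hb (hMK g hg))

theorem coneOf_dualStates {Ω : Type*} [TopologicalSpace Ω] {K : Set (Ω →ᵇ ℝ)}
    (hK : IsCoherent K) : coneOf (dualStates K) = K := by
  refine Set.Subset.antisymm (fun g hg => ?_) fun g hg L hL => hL.2 g hg
  by_contra hgK
  obtain ⟨L, hL, hLg⟩ := exists_mem_dualStates_neg hK hgK
  exact (hg L hL).not_gt hLg

theorem isCoherent_coneOf {Ω : Type*} [TopologicalSpace Ω] {P : Set (WeakDual ℝ (Ω →ᵇ ℝ))}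
    (hP : P ⊆ states Ω) (hne : P.Nonempty) : IsCoherent (coneOf P) := by
  refine ⟨?_, ?_, ?_, fun g hg L hL => (hP hL).1 g hg, ?_⟩
  · simp only [coneOf, Set.ofPred_forall]
    exact isClosed_iInter fun L => isClosed_iInter fun _ =>
      isClosed_le continuous_const (map_continuous L)
  · intro g hg h hh a b ha hb _ L hL
    rw [map_add, map_smul, map_smul]
    exact add_nonneg (mul_nonneg ha (hg L hL)) (mul_nonneg hb (hh L hL))
  · intro c hc g hg L hL
    rw [map_smul]
    exact mul_nonneg hc.le (hg L hL)
  · rw [Set.eq_empty_iff_forall_notMem]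
    rintro g ⟨hg, hneg⟩
    obtain ⟨L, hL⟩ := hne
    exact (hg L hL).not_gt ((hP hL).apply_neg hneg)

theorem exists_forall_lt_apply_of_notMem {E : Type*} [NormedAddCommGroup E] [NormedSpace ℝ E]
    {P : Set (WeakDual ℝ E)} (hconv : Convex ℝ P) (hcl : IsClosed P) {L : WeakDual ℝ E}
    (hL : L ∉ P) : ∃ (g : E) (u : ℝ), L g < u ∧ ∀ M ∈ P, u < M g := by
  have : LocallyConvexSpace ℝ (WeakDual ℝ E) :=
    inferInstanceAs (LocallyConvexSpace ℝ (WeakBilin (topDualPairing ℝ E)))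
  obtain ⟨f, u, hfL, hfP⟩ := geometric_hahn_banach_point_closed hconv hcl hL
  obtain ⟨g, hg⟩ := LinearMap.dualEmbedding_surjective (topDualPairing ℝ E) f
  have key : ∀ M : WeakDual ℝ E, f M = M g := fun M => (DFunLike.congr_fun hg M).symm
  exact ⟨g, u, key L ▸ hfL, fun M hM => key M ▸ hfP M hM⟩

theorem dualStates_coneOf {Ω : Type*} [TopologicalSpace Ω] {P : Set (WeakDual ℝ (Ω →ᵇ ℝ))}
    (hP : P ⊆ states Ω) (hcl : IsClosed P) (hconv : Convex ℝ P) :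
    dualStates (coneOf P) = P := by
  refine Set.Subset.antisymm (fun L hL => ?_) fun L hL => ⟨hP hL, fun g hg => hg L hL⟩
  by_contra hLP
  obtain ⟨g, u, hLg, hPg⟩ := exists_forall_lt_apply_of_notMem hconv hcl hLP
  have key : ∀ M : WeakDual ℝ (Ω →ᵇ ℝ), IsState M →
      M (g - u • BoundedContinuousFunction.const Ω (1 : ℝ)) = M g - u := fun M hM => by
    rw [map_sub, map_smul, hM.2, smul_eq_mul, mul_one]
  have h := hL.2 (g - u • BoundedContinuousFunction.const Ω (1 : ℝ)) fun M hM => by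
    rw [key M (hP hM)]
    exact sub_nonneg.2 (hPg M hM).le
  rw [key L hL.1] at h
  linarith

/-- `K ↦ K• ∩ 𝒮` is a bijection between coherent sets of desirable
gambles and nonempty weak*-closed convex subsets of `𝒮`, with inverse
`P ↦ {g : L(g) ≥ 0 ∀ L ∈ P}`. -/
theorem stmt2 {Ω : Type*} [Nonempty Ω] [TopologicalSpace Ω] [DiscreteTopology Ω] :
    (∀ K : Set (Ω →ᵇ ℝ), IsCoherent K →
      (dualStates K).Nonempty ∧ IsClosed (dualStates K) ∧ Convex ℝ (dualStates K) ∧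
        dualStates K ⊆ states Ω ∧ coneOf (dualStates K) = K)
    ∧ (∀ P : Set (WeakDual ℝ (Ω →ᵇ ℝ)), P ⊆ states Ω → P.Nonempty → IsClosed P →
        Convex ℝ P → IsCoherent (coneOf P) ∧ dualStates (coneOf P) = P) := by
  refine ⟨fun K hK => ⟨?_, isClosed_dualStates K, convex_dualStates K, fun L hL => hL.1,
    coneOf_dualStates hK⟩, fun P hP hne hcl hconv =>
    ⟨isCoherent_coneOf hP hne, dualStates_coneOf hP hcl hconv⟩⟩
  have hneg : -BoundedContinuousFunction.const Ω (1 : ℝ) ∉ K := fun h => by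
    have : -BoundedContinuousFunction.const Ω (1 : ℝ) ∈ K ∩ Lneg Ω := ⟨h, by simp [Lneg]⟩
    simp [hK.2.2.2.2] at this
  obtain ⟨L, hL, -⟩ := exists_mem_dualStates_neg hK hneg
  exact ⟨L, hL⟩
end
end

section
/- Let Σ≥ be a convex cone in 𝓛_R, closed in 𝓛_R, containing all nonnegative constant gambles, and assume additionally (*): for every f ∈ 𝓛_R there is ε > 0 with f + ε𝟙 ∈ Σ≥. Then for every 𝒢 ⊆ 𝓛_R, the natural extension N_B(𝒢) := cl(posi(Σ≥ ∪ 𝒢)) is P-coherent (i.e. N_B(𝒢) ∩ Σ< = ∅) if and only if N_B(𝒢) ≠ 𝓛_R. -/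
open BoundedContinuousFunction

noncomputable section

/-- The set `Σ<` of P-negative gambles relative to `Σ≥` and `𝓛_R`. -/
def Sneg {Ω : Type*} [TopologicalSpace Ω] (LR : Submodule ℝ (Ω →ᵇ ℝ))
    (Sig : Set (Ω →ᵇ ℝ)) : Set (Ω →ᵇ ℝ) :=
  {f | f ∈ LR ∧ ∃ δ : ℝ, 0 < δ ∧
    -f - δ • BoundedContinuousFunction.const Ω (1 : ℝ) ∈ Sig}

/-- The conic combinations of a set form its conic hull. -/
theorem posi_eq_hull {Ω : Type*} [TopologicalSpace Ω] (𝒢 : Set (Ω →ᵇ ℝ)) :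
    posi 𝒢 = (PointedCone.hull ℝ 𝒢 : Set (Ω →ᵇ ℝ)) := by
  ext h
  constructor
  · rintro ⟨ℓ, lam, gs, hlam, hgs, rfl⟩
    exact Submodule.sum_mem _ fun i _ =>
      PointedCone.smul_mem _ (hlam i) (Submodule.subset_span (hgs i))
  · intro hh
    obtain ⟨ℓ, lam, gs, rfl⟩ := Submodule.mem_span_set'.1 hh
    exact ⟨ℓ, fun i => (lam i : ℝ), fun i => gs i, fun i => (lam i).2, fun i => (gs i).2, rfl⟩

/-- with `Σ≥` a closed convex cone in `𝓛_R` containing the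
nonnegative constants and satisfying (*): every `f ∈ 𝓛_R` has `f + ε𝟙 ∈ Σ≥` for
some `ε > 0`, the natural extension `N_B(𝒢) = cl (posi (Σ≥ ∪ 𝒢))` is P-coherent
iff `N_B(𝒢) ≠ 𝓛_R`. -/
theorem stmt6 {Ω : Type*} [Nonempty Ω] [TopologicalSpace Ω] [DiscreteTopology Ω]
    (LR : Submodule ℝ (Ω →ᵇ ℝ)) (hLRclosed : IsClosed (LR : Set (Ω →ᵇ ℝ)))
    (hLRconst : ∀ c : ℝ, BoundedContinuousFunction.const Ω c ∈ LR)
    (Sig : Set (Ω →ᵇ ℝ)) (hSigsub : Sig ⊆ (LR : Set (Ω →ᵇ ℝ)))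
    (hSigconv : Convex ℝ Sig) (hSigcone : ∀ c : ℝ, 0 < c → ∀ g ∈ Sig, c • g ∈ Sig)
    (hSigclosed : IsClosed Sig)
    (hSigconst : ∀ c : ℝ, 0 ≤ c → BoundedContinuousFunction.const Ω c ∈ Sig)
    (hstar : ∀ f ∈ LR, ∃ ε : ℝ, 0 < ε ∧
      f + ε • BoundedContinuousFunction.const Ω (1 : ℝ) ∈ Sig)
    (𝒢 : Set (Ω →ᵇ ℝ)) (h𝒢 : 𝒢 ⊆ (LR : Set (Ω →ᵇ ℝ))) :
    closure (posi (Sig ∪ 𝒢)) ∩ Sneg LR Sig = ∅ ↔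
      closure (posi (Sig ∪ 𝒢)) ≠ (LR : Set (Ω →ᵇ ℝ)) := by
  rw [posi_eq_hull, ← PointedCone.coe_closure]
  set N : PointedCone ℝ (Ω →ᵇ ℝ) := (PointedCone.hull ℝ (Sig ∪ 𝒢)).closure with hN
  set one : Ω →ᵇ ℝ := BoundedContinuousFunction.const Ω (1 : ℝ) with hone
  have hSigN : Sig ⊆ N := fun g hg =>
    PointedCone.mem_closure.2 (subset_closure (Submodule.subset_span (Or.inl hg)))
  have hNLR : (N : Set (Ω →ᵇ ℝ)) ⊆ LR := by
    rw [hN, PointedCone.coe_closure]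
    refine closure_minimal (fun g hg => ?_) hLRclosed
    have hle : PointedCone.hull ℝ (Sig ∪ 𝒢) ≤ PointedCone.ofSubmodule LR :=
      Submodule.span_le.2 (Set.union_subset hSigsub h𝒢)
    exact hle hg
  constructor
  · intro hempty heq
    have hone_mem : -one ∈ LR := LR.neg_mem (hLRconst 1)
    have hneg : -one ∈ Sneg LR Sig := by
      refine ⟨hone_mem, 1, one_pos, ?_⟩
      have hzero : - -one - (1 : ℝ) • one = BoundedContinuousFunction.const Ω (0 : ℝ) := by
        rw [neg_neg, one_smul, sub_self]
        rfl
      rw [hzero]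
      exact hSigconst 0 le_rfl
    exact (hempty.le ⟨heq.ge hone_mem, hneg⟩ : -one ∈ (∅ : Set (Ω →ᵇ ℝ)))
  · intro hne
    refine Set.eq_empty_of_forall_notMem fun f hf => hne (hNLR.antisymm fun h hh => ?_)
    obtain ⟨hfN, -, δ, hδ, hfδ⟩ := hf
    obtain ⟨ε, hε, hhε⟩ := hstar h hh
    have hsum := N.add_mem (hSigN hhε)
      (PointedCone.smul_mem N (div_pos hε hδ).le (N.add_mem hfN (hSigN hfδ)))
    have hdecomp : h + ε • one + (ε / δ) • (f + (-f - δ • one)) = h := by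
      have hcancel : f + (-f - δ • one) = -(δ • one) := by abel
      rw [hcancel, smul_neg, smul_smul, div_mul_cancel₀ ε hδ.ne']
      abel
    rwa [hdecomp] at hsum
end
end

section
/- Let 𝓛_R be a closed linear subspace of 𝓛 containing all constant gambles, set 𝓛≥_R := 𝓛≥ ∩ 𝓛_R, and for 𝒢_R ⊆ 𝓛_R define N_R(𝒢_R) := cl(posi(𝓛≥_R ∪ 𝒢_R)) with closure taken in 𝓛_R. Then N_R(𝒢_R) is coherent (N_R(𝒢_R) ∩ 𝓛< = ∅) if and only if the natural extension N(𝒢_R) = cl(posi(𝓛≥ ∪ 𝒢_R)) in 𝓛 is coherent (N(𝒢_R) ∩ 𝓛< = ∅); moreover N_R(𝒢_R) = 𝓛_R ∩ N(𝒢_R). -/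
open BoundedContinuousFunction

noncomputable section

/-- The relative natural extension `N_R(𝒢_R) = cl (posi (𝓛≥_R ∪ 𝒢_R))`, where
`𝓛≥_R = 𝓛≥ ∩ 𝓛_R`.  (Since `𝓛_R` is a closed subspace containing the combination
being closed, the closure taken in `𝓛_R` coincides with the ambient closure.) -/
def natExtR {Ω : Type*} [TopologicalSpace Ω] (LR : Submodule ℝ (Ω →ᵇ ℝ))
    (𝒢R : Set (Ω →ᵇ ℝ)) : Set (Ω →ᵇ ℝ) :=
  closure (posi ((Lnn Ω ∩ (LR : Set (Ω →ᵇ ℝ))) ∪ 𝒢R))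

open scoped NNReal

theorem posi_mono {Ω : Type*} [TopologicalSpace Ω] {𝒢 ℋ : Set (Ω →ᵇ ℝ)} (h : 𝒢 ⊆ ℋ) :
    posi 𝒢 ⊆ posi ℋ := by
  rw [posi_eq_span, posi_eq_span]
  exact Submodule.span_mono h

theorem posi_subset_submodule {Ω : Type*} [TopologicalSpace Ω] {𝒢 : Set (Ω →ᵇ ℝ)}
    {L : Submodule ℝ (Ω →ᵇ ℝ)} (h : 𝒢 ⊆ (L : Set (Ω →ᵇ ℝ))) :
    posi 𝒢 ⊆ (L : Set (Ω →ᵇ ℝ)) := by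
  rintro _ ⟨ℓ, lam, gs, -, hgs, rfl⟩
  exact sum_mem fun i _ => L.smul_mem _ (h (hgs i))

theorem subset_posi {Ω : Type*} [TopologicalSpace Ω] (𝒢 : Set (Ω →ᵇ ℝ)) : 𝒢 ⊆ posi 𝒢 := by
  rw [posi_eq_span]
  exact Submodule.subset_span

theorem add_mem_posi {Ω : Type*} [TopologicalSpace Ω] {𝒢 : Set (Ω →ᵇ ℝ)} {f g : Ω →ᵇ ℝ}
    (hf : f ∈ posi 𝒢) (hg : g ∈ posi 𝒢) : f + g ∈ posi 𝒢 := by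
  rw [posi_eq_span] at *
  exact add_mem hf hg

theorem exists_nonneg_add_posi {Ω : Type*} [TopologicalSpace Ω] {𝒢 : Set (Ω →ᵇ ℝ)}
    {p : Ω →ᵇ ℝ} (hp : p ∈ posi (Lnn Ω ∪ 𝒢)) :
    ∃ n ∈ Lnn Ω, ∃ g ∈ posi 𝒢, n + g = p := by
  rw [posi_eq_span, SetLike.mem_coe, Submodule.span_union, Submodule.mem_sup] at hp
  obtain ⟨n, hn, g, hg, rfl⟩ := hp
  refine ⟨n, ?_, g, by rwa [posi_eq_span], rfl⟩
  have hn' : n ∈ posi (Lnn Ω) := by rwa [posi_eq_span]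
  obtain ⟨ℓ, lam, gs, hlam, hgs, rfl⟩ := hn'
  intro ω
  rw [BoundedContinuousFunction.sum_apply]
  exact Finset.sum_nonneg fun i _ => mul_nonneg (hlam i) (hgs i ω)

theorem add_mem_natExt {Ω : Type*} [TopologicalSpace Ω] {𝒢 : Set (Ω →ᵇ ℝ)} {f n : Ω →ᵇ ℝ}
    (hf : f ∈ natExt 𝒢) (hn : n ∈ Lnn Ω) : f + n ∈ natExt 𝒢 :=
  map_mem_closure (f := (· + n)) (continuous_id.add continuous_const) hf fun _ hp =>
    add_mem_posi hp (subset_posi _ (Or.inl hn))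

theorem natExtR_subset_natExt {Ω : Type*} [TopologicalSpace Ω] (LR : Submodule ℝ (Ω →ᵇ ℝ))
    (𝒢 : Set (Ω →ᵇ ℝ)) : natExtR LR 𝒢 ⊆ natExt 𝒢 :=
  closure_mono (posi_mono (Set.union_subset_union_left _ Set.inter_subset_left))

theorem natExtR_eq_inter_natExt {Ω : Type*} [TopologicalSpace Ω]
    {LR : Submodule ℝ (Ω →ᵇ ℝ)} (hclosed : IsClosed (LR : Set (Ω →ᵇ ℝ)))
    (hconst : ∀ c : ℝ, BoundedContinuousFunction.const Ω c ∈ LR)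
    {𝒢 : Set (Ω →ᵇ ℝ)} (h𝒢 : 𝒢 ⊆ (LR : Set (Ω →ᵇ ℝ))) :
    natExtR LR 𝒢 = (LR : Set (Ω →ᵇ ℝ)) ∩ natExt 𝒢 := by
  refine Set.Subset.antisymm (Set.subset_inter ?_ (natExtR_subset_natExt LR 𝒢)) ?_
  · exact closure_minimal
      (posi_subset_submodule (Set.union_subset Set.inter_subset_right h𝒢)) hclosed
  rintro h ⟨hLR, hN⟩
  refine Metric.mem_closure_iff.2 fun ε hε => ?_
  obtain ⟨p, hp, hdist⟩ := Metric.mem_closure_iff.1 hN (ε / 2) (half_pos hε)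
  obtain ⟨n, hn, g, hg, rfl⟩ := exists_nonneg_add_posi hp
  refine ⟨(h - g + BoundedContinuousFunction.const Ω (ε / 2)) + g, add_mem_posi
    (subset_posi _ (Or.inl ⟨fun ω => ?_, ?_⟩)) (posi_mono Set.subset_union_right hg), ?_⟩
  · have hω := (BoundedContinuousFunction.dist_coe_le_dist (f := h) (g := n + g) ω).trans hdist.le
    rw [Real.dist_eq, abs_le] at hω
    have hnω := hn ω
    simp only [BoundedContinuousFunction.coe_add, BoundedContinuousFunction.coe_sub,
      Pi.add_apply, Pi.sub_apply, BoundedContinuousFunction.const_apply] at hω ⊢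
    linarith [hω.1]
  · exact add_mem (sub_mem hLR (posi_subset_submodule h𝒢 hg)) (hconst _)
  · refine lt_of_le_of_lt ((BoundedContinuousFunction.dist_le (half_pos hε).le).2 fun ω => ?_)
      (half_lt_self hε)
    have hω : h ω - (h ω - g ω + ε / 2 + g ω) = -(ε / 2) := by ring
    simp [Real.dist_eq, hω, abs_of_pos (half_pos hε)]

theorem const_iSup_mem_natExt {Ω : Type*} [TopologicalSpace Ω] {𝒢 : Set (Ω →ᵇ ℝ)} {f : Ω →ᵇ ℝ}
    (hf : f ∈ natExt 𝒢) : BoundedContinuousFunction.const Ω (⨆ ω, f ω) ∈ natExt 𝒢 := by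
  rw [← add_sub_cancel f (BoundedContinuousFunction.const Ω (⨆ ω, f ω))]
  refine add_mem_natExt hf fun ω => sub_nonneg.2 ?_
  exact le_ciSup f.isBounded_range.bddAbove ω

/-- for a closed linear subspace `𝓛_R` of `𝓛` containing all
constants and `𝒢_R ⊆ 𝓛_R`, `N_R(𝒢_R)` is coherent iff `N(𝒢_R)` is coherent, and
moreover `N_R(𝒢_R) = 𝓛_R ∩ N(𝒢_R)`. -/
theorem stmt7 {Ω : Type*} [Nonempty Ω] [TopologicalSpace Ω] [DiscreteTopology Ω]
    (LR : Submodule ℝ (Ω →ᵇ ℝ)) (hLRclosed : IsClosed (LR : Set (Ω →ᵇ ℝ)))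
    (hLRconst : ∀ c : ℝ, BoundedContinuousFunction.const Ω c ∈ LR)
    (𝒢R : Set (Ω →ᵇ ℝ)) (h𝒢R : 𝒢R ⊆ (LR : Set (Ω →ᵇ ℝ))) :
    (natExtR LR 𝒢R ∩ Lneg Ω = ∅ ↔ natExt 𝒢R ∩ Lneg Ω = ∅)
    ∧ natExtR LR 𝒢R = (LR : Set (Ω →ᵇ ℝ)) ∩ natExt 𝒢R := by
  have heq := natExtR_eq_inter_natExt hLRclosed hLRconst h𝒢R
  refine ⟨⟨fun hR => ?_, fun hN => ?_⟩, heq⟩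
  · refine Set.eq_empty_of_forall_notMem fun f hf => ?_
    refine Set.notMem_empty (BoundedContinuousFunction.const Ω (⨆ ω, f ω)) (hR ▸ ⟨?_, ?_⟩)
    · exact heq ▸ ⟨hLRconst _, const_iSup_mem_natExt hf.1⟩
    · simpa [Lneg] using hf.2
  · exact Set.subset_eq_empty (Set.inter_subset_inter_left _ (natExtR_subset_natExt LR 𝒢R)) hN
end
end

section
/- Let m ≥ 1, n_1,…,n_m ≥ 1, n = n_1⋯n_m, and for unit vectors x_j ∈ ℂ^{n_j} let X := (x_1⊗⋯⊗x_m)(x_1⊗⋯⊗x_m)† ∈ ℂ^{n×n}. Fix indices s ≤ t in {1,…,n}. Then for indices (k,l) ∈ {1,…,n}²: the entry X_{st} equals X_{kl} for every choice of unit vectors x_1,…,x_m if and only if k = s and l = t. -/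
open Matrix

noncomputable section

/-- The entries of the Kronecker product `x₁ ⊗ ⋯ ⊗ x_m` of column vectors,
indexed by tuples `k` with `k j ∈ Fin (nd j)`: the entry at `k` is `∏ j, x j (k j)`. -/
def kronVec {m : ℕ} {nd : Fin m → ℕ} (x : ∀ j : Fin m, Fin (nd j) → ℂ) :
    (∀ j : Fin m, Fin (nd j)) → ℂ :=
  fun k => ∏ j, x j (k j)

/-- Every nonzero complex vector has a nonzero multiple that is a unit vector. -/
theorem exists_smul_star_dotProduct_eq_one {ι : Type*} [Fintype ι] (y : ι → ℂ) (hy : y ≠ 0) :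
    ∃ c : ℂ, c ≠ 0 ∧ star (c • y) ⬝ᵥ (c • y) = 1 := by
  have hsum : star y ⬝ᵥ y = ((∑ i, Complex.normSq (y i) : ℝ) : ℂ) := by
    simp [dotProduct, Complex.normSq_eq_conj_mul_self]
  set r : ℝ := ∑ i, Complex.normSq (y i)
  have hr0 : 0 ≤ r := Finset.sum_nonneg fun i _ => Complex.normSq_nonneg _
  have hrne : r ≠ 0 := by
    intro h
    rw [h, Complex.ofReal_zero] at hsum
    open ComplexOrder in exact hy (dotProduct_star_self_eq_zero.1 hsum)
  have hsq : Real.sqrt r ≠ 0 := (Real.sqrt_pos.2 (lt_of_le_of_ne hr0 hrne.symm)).ne'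
  refine ⟨((Real.sqrt r)⁻¹ : ℝ), by exact_mod_cast inv_ne_zero hsq, ?_⟩
  rw [star_smul, smul_dotProduct, dotProduct_smul, hsum]
  simp only [smul_eq_mul, Complex.star_def, Complex.conj_ofReal]
  norm_cast
  field_simp
  rw [Real.sq_sqrt hr0]

theorem kronVec_smul {m : ℕ} {nd : Fin m → ℕ} (c : Fin m → ℂ)
    (x : ∀ j : Fin m, Fin (nd j) → ℂ) (k : ∀ j : Fin m, Fin (nd j)) :
    kronVec (fun j => c j • x j) k = (∏ j, c j) * kronVec x k := by
  simp [kronVec, Finset.prod_mul_distrib]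

/-- By homogeneity, an identity between entries on unit vectors extends to nonzero vectors. -/
theorem kronVec_entry_eq_of_ne_zero {m : ℕ} {nd : Fin m → ℕ} {s t k l : ∀ j : Fin m, Fin (nd j)}
    (h : ∀ x : ∀ j : Fin m, Fin (nd j) → ℂ, (∀ j, star (x j) ⬝ᵥ x j = 1) →
        kronVec x s * (starRingEnd ℂ) (kronVec x t) =
          kronVec x k * (starRingEnd ℂ) (kronVec x l))
    (y : ∀ j : Fin m, Fin (nd j) → ℂ) (hy : ∀ j, y j ≠ 0) :
    kronVec y s * (starRingEnd ℂ) (kronVec y t) =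
      kronVec y k * (starRingEnd ℂ) (kronVec y l) := by
  choose c hc hunit using fun j => exists_smul_star_dotProduct_eq_one (y j) (hy j)
  have hC : (∏ j, c j) ≠ 0 := Finset.prod_ne_zero_iff.2 fun j _ => hc j
  have hC' : (starRingEnd ℂ) (∏ j, c j) ≠ 0 := (map_ne_zero _).2 hC
  have key := h (fun j => c j • y j) hunit
  simp only [kronVec_smul, map_mul (starRingEnd ℂ) (∏ j, c j)] at key
  apply mul_left_cancel₀ (mul_ne_zero hC hC')
  linear_combination key

/-- The vectors with all entries `1`, except for the entry `2i` at position `a` of `x_j`. -/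
def spike {m : ℕ} (nd : Fin m → ℕ) (j : Fin m) (a : Fin (nd j)) :
    ∀ i : Fin m, Fin (nd i) → ℂ :=
  Function.update (fun _ _ => 1) j (Function.update (fun _ => 1) a (2 * Complex.I))

theorem kronVec_spike {m : ℕ} {nd : Fin m → ℕ} (j : Fin m) (a : Fin (nd j))
    (k : ∀ j : Fin m, Fin (nd j)) :
    kronVec (spike nd j a) k = if k j = a then 2 * Complex.I else 1 := by
  rw [kronVec, Finset.prod_eq_single j]
  · simp [spike, Function.update_apply]
  · intro i _ hi
    simp [spike, hi]
  · simp

theorem spike_ne_zero {m : ℕ} {nd : Fin m → ℕ} (hnd : ∀ j, 1 ≤ nd j) (j : Fin m)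
    (a : Fin (nd j)) (i : Fin m) : spike nd j a i ≠ 0 := by
  intro h
  by_cases hi : i = j
  · subst hi
    simpa [spike] using congrFun h a
  · simpa [spike, hi] using congrFun h ⟨0, hnd i⟩

/-- The entries of the rank-one matrix of a spike determine whether each index is the spike. -/
theorem spike_entry_iff {p q p' q' : Prop} [Decidable p] [Decidable q] [Decidable p']
    [Decidable q']
    (h : (if p then 2 * Complex.I else 1) * (starRingEnd ℂ) (if q then 2 * Complex.I else 1) =
      (if p' then 2 * Complex.I else 1) * (starRingEnd ℂ) (if q' then 2 * Complex.I else 1)) :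
    (p ↔ p') ∧ (q ↔ q') := by
  by_cases hp : p <;> by_cases hq : q <;> by_cases hp' : p' <;> by_cases hq' : q' <;>
    simp [hp, hq, hp', hq', Complex.ext_iff] at h ⊢ <;> norm_num at h

/-- for `X = (x₁⊗⋯⊗x_m)(x₁⊗⋯⊗x_m)†` and indices `s ≤ t`
(lexicographically, matching the row enumeration of the matrix), the entry
`X_{st}` agrees with `X_{kl}` for every choice of unit vectors `x₁,…,x_m` iff
`k = s` and `l = t`.  Here `X_{st} = (∏ⱼ x_j(s_j)) · conj (∏ⱼ x_j(t_j))`. -/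
theorem stmt10 (m : ℕ) (hm : 1 ≤ m) (nd : Fin m → ℕ) (hnd : ∀ j, 1 ≤ nd j)
    (s t : ∀ j : Fin m, Fin (nd j))
    (hst : s = t ∨ ∃ j : Fin m, (∀ i : Fin m, i < j → s i = t i) ∧ s j < t j)
    (k l : ∀ j : Fin m, Fin (nd j)) :
    (∀ x : ∀ j : Fin m, Fin (nd j) → ℂ, (∀ j, star (x j) ⬝ᵥ x j = 1) →
        kronVec x s * (starRingEnd ℂ) (kronVec x t) =
          kronVec x k * (starRingEnd ℂ) (kronVec x l)) ↔
      (k = s ∧ l = t) := by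
  constructor
  · intro h
    have key (j : Fin m) (a : Fin (nd j)) : (s j = a ↔ k j = a) ∧ (t j = a ↔ l j = a) := by
      have := kronVec_entry_eq_of_ne_zero h (spike nd j a) (spike_ne_zero hnd j a)
      simp only [kronVec_spike] at this
      exact spike_entry_iff this
    exact ⟨funext fun j => (key j (s j)).1.1 rfl, funext fun j => (key j (t j)).2.1 rfl⟩
  · rintro ⟨rfl, rfl⟩ x _
    rfl
end
end

section
/- Let ρ be a density matrix on ℂ^{n₁n₂}. Then: (a) ρ is entangled if and only if there exists an entanglement witness W (a Hermitian matrix that is not positive semidefinite but satisfies (x⊗y)†W(x⊗y) ≥ 0 for all x ∈ ℂ^{n₁}, y ∈ ℂ^{n₂}) such that Tr(ρW) < 0; (b) ρ is separable if and only if Tr(ρW) ≥ 0 for every entanglement witness W. -/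
open Matrix Kronecker
open scoped ComplexOrder

noncomputable section

/-- The Kronecker product of column vectors `x ∈ ℂ^{n₁}`, `y ∈ ℂ^{n₂}`. -/
def vKron {n₁ n₂ : ℕ} (x : Fin n₁ → ℂ) (y : Fin n₂ → ℂ) : Fin n₁ × Fin n₂ → ℂ :=
  fun p => x p.1 * y p.2

/-- A density matrix: positive semidefinite (hence Hermitian) with trace 1. -/
def IsDensity {d : Type*} [Fintype d] [DecidableEq d] (ρ : Matrix d d ℂ) : Prop :=
  ρ.PosSemidef ∧ ρ.trace = 1

/-- Separability: `ρ = Σᵢ pᵢ (ρᵢᴬ ⊗ ρᵢᴮ)` with `pᵢ ≥ 0`, `Σ pᵢ = 1` and density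
matrices `ρᵢᴬ`, `ρᵢᴮ`. -/
def Separable {n₁ n₂ : ℕ} (ρ : Matrix (Fin n₁ × Fin n₂) (Fin n₁ × Fin n₂) ℂ) :
    Prop :=
  ∃ (k : ℕ) (p : Fin k → ℝ) (A : Fin k → Matrix (Fin n₁) (Fin n₁) ℂ)
      (B : Fin k → Matrix (Fin n₂) (Fin n₂) ℂ),
    (∀ i, 0 ≤ p i) ∧ (∑ i, p i = 1) ∧ (∀ i, IsDensity (A i)) ∧
      (∀ i, IsDensity (B i)) ∧ ρ = ∑ i, p i • (A i ⊗ₖ B i)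

/-- An entanglement witness: a Hermitian matrix that is not positive
semidefinite but has `(x⊗y)† W (x⊗y) ≥ 0` for all `x`, `y`. -/
def IsWitness {n₁ n₂ : ℕ} (W : Matrix (Fin n₁ × Fin n₂) (Fin n₁ × Fin n₂) ℂ) :
    Prop :=
  W.IsHermitian ∧ ¬W.PosSemidef ∧
    ∀ (x : Fin n₁ → ℂ) (y : Fin n₂ → ℂ), 0 ≤ star (vKron x y) ⬝ᵥ W *ᵥ vKron x y

/-- In finite dimension, the convex hull of a compact set is compact. -/
theorem isCompact_convexHull_of_finiteDimensional {E : Type*} [AddCommGroup E] [Module ℝ E]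
    [TopologicalSpace E] [ContinuousAdd E] [ContinuousSMul ℝ E] [FiniteDimensional ℝ E]
    {s : Set E} (hs : IsCompact s) : IsCompact (convexHull ℝ s) := by
  let m := Module.finrank ℝ E + 1
  let F : (Fin m → ℝ) × (Fin m → E) → E := fun q => ∑ i, q.1 i • q.2 i
  have hF : Continuous F := by fun_prop
  have hK : IsCompact (stdSimplex ℝ (Fin m) ×ˢ Set.univ.pi fun _ : Fin m => s) :=
    (isCompact_stdSimplex ℝ (Fin m)).prod (isCompact_univ_pi fun _ => hs)
  convert hK.image hF using 1
  refine Set.Subset.antisymm (fun x hx => ?_) ?_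
  · obtain ⟨ι, _, z, w, hz, hai, hw, hw1, rfl⟩ := eq_pos_convex_span_of_mem_convexHull hx
    obtain ⟨z₀, hz₀⟩ : s.Nonempty := convexHull_nonempty_iff.1 ⟨_, hx⟩
    have hcard : Fintype.card ι ≤ Fintype.card (Fin m) := by
      rw [Fintype.card_fin]
      exact hai.card_le_finrank_succ.trans
        (Nat.succ_le_succ (Submodule.finrank_le _))
    obtain ⟨e⟩ := Function.Embedding.nonempty_of_card_le hcard
    refine ⟨(Function.extend e w 0, Function.extend e z fun _ => z₀), ⟨⟨fun j => ?_, ?_⟩, ?_⟩, ?_⟩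
    · by_cases hj : ∃ i, e i = j
      · obtain ⟨i, rfl⟩ := hj
        simpa [e.injective.extend_apply] using (hw i).le
      · simp [Function.extend_apply' _ _ _ hj]
    · rw [← hw1]
      refine (Fintype.sum_of_injective e e.injective _ _ (fun j hj => ?_) fun i => ?_).symm
      · exact Function.extend_apply' _ _ _ hj
      · exact (e.injective.extend_apply _ _ _).symm
    · intro j _
      by_cases hj : ∃ i, e i = j
      · obtain ⟨i, rfl⟩ := hj
        simpa [e.injective.extend_apply] using hz ⟨i, rfl⟩
      · simpa [Function.extend_apply' _ _ _ hj] using hz₀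
    · refine (Fintype.sum_of_injective e e.injective _ _ (fun j hj => ?_) fun i => ?_).symm
      · simp [Function.extend_apply' _ _ _ hj]
      · simp [e.injective.extend_apply]
  · rintro _ ⟨⟨w, z⟩, ⟨hw, hz⟩, rfl⟩
    exact mem_convexHull_of_exists_fintype w z hw.1 hw.2 (fun i => hz i trivial) rfl

section Matrices

variable {d : Type*} [Fintype d]

theorem trace_vecMulVec_star_mul (v : d → ℂ) (W : Matrix d d ℂ) :
    (vecMulVec v (star v) * W).trace = star v ⬝ᵥ W *ᵥ v := by
  rw [vecMulVec_mul, trace_vecMulVec, dotProduct_comm, dotProduct_mulVec]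

/-- A real-linear functional agrees on Hermitian matrices with `X ↦ Tr (X W)`, `W` Hermitian. -/
theorem exists_isHermitian_trace_mul_eq [DecidableEq d] (f : Matrix d d ℂ →ₗ[ℝ] ℝ) :
    ∃ W : Matrix d d ℂ, W.IsHermitian ∧
      ∀ X : Matrix d d ℂ, X.IsHermitian → (X * W).trace = (f X : ℂ) := by
  let g : Module.Dual ℂ (Matrix d d ℂ) := Module.Dual.extendRCLike f
  let G : Matrix d d ℂ := of fun j i => g (single i j 1)
  have hG : ∀ X, (X * G).trace = g X := by
    intro X
    conv_rhs => rw [matrix_eq_sum_single X]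
    simp only [map_sum, trace, diag_apply, mul_apply]
    refine Finset.sum_congr rfl fun i _ => Finset.sum_congr rfl fun j _ => ?_
    rw [← mul_one (X i j), ← smul_eq_mul (X i j) 1, ← smul_single, map_smul]
    simp [G]
  refine ⟨(2⁻¹ : ℂ) • (G + Gᴴ), ?_, fun X hX => ?_⟩
  · simp [IsHermitian, conjTranspose_smul, add_comm]
  · have h1 : (X * Gᴴ).trace = star (X * G).trace := by
      rw [← trace_conjTranspose, conjTranspose_mul, hX.eq, trace_mul_comm]
    have h2 : (g X).re = f X :=
      Module.Dual.re_extendRCLike_apply (𝕜 := ℂ) f X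
    rw [mul_smul_comm, trace_smul, mul_add, trace_add, h1, hG, ← h2, smul_eq_mul]
    rw [Complex.star_def, Complex.add_conj]
    push_cast
    ring

theorem Matrix.PosSemidef.trace_mul_nonneg {A B : Matrix d d ℂ} (hA : A.PosSemidef)
    (hB : B.PosSemidef) : 0 ≤ (A * B).trace := by
  obtain ⟨m, v, rfl⟩ := posSemidef_iff_eq_sum_vecMulVec.mp hA
  rw [Finset.sum_mul, trace_sum]
  refine Finset.sum_nonneg fun i _ => ?_
  rw [trace_vecMulVec_star_mul]
  exact hB.dotProduct_mulVec_nonneg _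

theorem isDensity_vecMulVec_star {n : ℕ} {x : EuclideanSpace ℂ (Fin n)} (hx : ‖x‖ = 1) :
    IsDensity (vecMulVec x.ofLp (star x.ofLp)) := by
  refine ⟨posSemidef_vecMulVec_self_star _, ?_⟩
  rw [trace_vecMulVec, ← EuclideanSpace.inner_eq_star_dotProduct, inner_self_eq_norm_sq_to_K, hx]
  simp

end Matrices

section Bipartite

variable {n₁ n₂ : ℕ}

theorem vecMulVec_vKron_star (x : Fin n₁ → ℂ) (y : Fin n₂ → ℂ) :
    vecMulVec (vKron x y) (star (vKron x y)) =
      vecMulVec x (star x) ⊗ₖ vecMulVec y (star y) := by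
  ext i j
  simp [vecMulVec_apply, vKron]
  ring

theorem vKron_smul_smul (a b : ℂ) (x : Fin n₁ → ℂ) (y : Fin n₂ → ℂ) :
    vKron (a • x) (b • y) = (a * b) • vKron x y := by
  ext i
  simp [vKron]
  ring

/-- The rank one projections onto product vectors. -/
def productProjections (n₁ n₂ : ℕ) : Set (Matrix (Fin n₁ × Fin n₂) (Fin n₁ × Fin n₂) ℂ) :=
  (fun q : EuclideanSpace ℂ (Fin n₁) × EuclideanSpace ℂ (Fin n₂) =>
      vecMulVec (vKron q.1.ofLp q.2.ofLp) (star (vKron q.1.ofLp q.2.ofLp))) ''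
    (Metric.sphere 0 1 ×ˢ Metric.sphere 0 1)

theorem isCompact_productProjections : IsCompact (productProjections n₁ n₂) := by
  refine ((isCompact_sphere _ _).prod (isCompact_sphere _ _)).image ?_
  refine continuous_matrix fun i j => ?_
  simp only [vecMulVec_apply, vKron, Pi.star_apply]
  fun_prop

theorem separable_of_mem_convexHull {ρ : Matrix (Fin n₁ × Fin n₂) (Fin n₁ × Fin n₂) ℂ}
    (h : ρ ∈ convexHull ℝ (productProjections n₁ n₂)) : Separable ρ := by
  obtain ⟨ι, _, w, z, hw, hw1, hz, rfl⟩ := mem_convexHull_iff_exists_fintype.1 h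
  choose q hq hqz using hz
  let e := (Fintype.equivFin ι).symm
  refine ⟨Fintype.card ι, fun i => w (e i),
    fun i => vecMulVec (q (e i)).1.ofLp (star (q (e i)).1.ofLp),
    fun i => vecMulVec (q (e i)).2.ofLp (star (q (e i)).2.ofLp), fun i => hw _, ?_,
    fun i => isDensity_vecMulVec_star (by simpa using (hq (e i)).1),
    fun i => isDensity_vecMulVec_star (by simpa using (hq (e i)).2), ?_⟩
  · rw [← hw1]
    exact e.sum_comp w
  · rw [← e.sum_comp]
    simp only [← vecMulVec_vKron_star, ← hqz]

theorem Separable.trace_mul_nonneg {ρ W : Matrix (Fin n₁ × Fin n₂) (Fin n₁ × Fin n₂) ℂ}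
    (hρ : Separable ρ)
    (hW : ∀ (x : Fin n₁ → ℂ) (y : Fin n₂ → ℂ), 0 ≤ star (vKron x y) ⬝ᵥ W *ᵥ vKron x y) :
    0 ≤ (ρ * W).trace := by
  obtain ⟨k, p, A, B, hp, -, hA, hB, rfl⟩ := hρ
  rw [Finset.sum_mul, trace_sum]
  refine Finset.sum_nonneg fun i _ => ?_
  rw [smul_mul_assoc, trace_smul]
  refine smul_nonneg (hp i) ?_
  obtain ⟨m, v, hv⟩ := posSemidef_iff_eq_sum_vecMulVec.mp (hA i).1
  obtain ⟨l, u, hu⟩ := posSemidef_iff_eq_sum_vecMulVec.mp (hB i).1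
  have hAB : A i ⊗ₖ B i =
      ∑ a, ∑ b, vecMulVec (vKron (v a) (u b)) (star (vKron (v a) (u b))) := by
    simp only [vecMulVec_vKron_star]
    rw [hv, hu]
    ext r s
    simp only [kroneckerMap_apply, Matrix.sum_apply, Finset.sum_mul_sum]
  rw [hAB, Finset.sum_mul, trace_sum]
  refine Finset.sum_nonneg fun a _ => ?_
  rw [Finset.sum_mul, trace_sum]
  refine Finset.sum_nonneg fun b _ => ?_
  rw [trace_vecMulVec_star_mul]
  exact hW _ _

/-- Nonnegativity on products of unit vectors implies nonnegativity on all product vectors. -/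
theorem dotProduct_mulVec_vKron_nonneg {W : Matrix (Fin n₁ × Fin n₂) (Fin n₁ × Fin n₂) ℂ}
    (hW : ∀ P ∈ productProjections n₁ n₂, 0 ≤ (P * W).trace)
    (x : Fin n₁ → ℂ) (y : Fin n₂ → ℂ) : 0 ≤ star (vKron x y) ⬝ᵥ W *ᵥ vKron x y := by
  have scale : ∀ {n : ℕ} (x : Fin n → ℂ), x ≠ 0 →
      ∃ (a : ℂ) (x' : EuclideanSpace ℂ (Fin n)), ‖x'‖ = 1 ∧ x = a • x'.ofLp := by
    intro n x hx
    have h0 : ‖WithLp.toLp 2 x‖ ≠ 0 := by simpa using hx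
    refine ⟨(‖WithLp.toLp 2 x‖ : ℂ), (‖WithLp.toLp 2 x‖ : ℂ)⁻¹ • WithLp.toLp 2 x, ?_, ?_⟩
    · simp [norm_smul, h0]
    · have h0' : (‖WithLp.toLp 2 x‖ : ℂ) ≠ 0 := by exact_mod_cast h0
      rw [WithLp.ofLp_smul, smul_smul, mul_inv_cancel₀ h0', one_smul]
  by_cases hx : x = 0
  · have : vKron x y = 0 := by ext; simp [vKron, hx]
    simp [this]
  by_cases hy : y = 0
  · have : vKron x y = 0 := by ext; simp [vKron, hy]
    simp [this]
  obtain ⟨a, x', hx', rfl⟩ := scale x hx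
  obtain ⟨b, y', hy', rfl⟩ := scale y hy
  have h := hW _ ⟨(x', y'), ⟨by simpa using hx', by simpa using hy'⟩, rfl⟩
  rw [trace_vecMulVec_star_mul] at h
  rw [vKron_smul_smul, star_smul, smul_dotProduct, mulVec_smul, dotProduct_smul, smul_smul]
  exact mul_nonneg (star_mul_self_nonneg _) h

theorem exists_isWitness_of_not_separable
    {ρ : Matrix (Fin n₁ × Fin n₂) (Fin n₁ × Fin n₂) ℂ} (hρ : IsDensity ρ) (h : ¬Separable ρ) :
    ∃ W, IsWitness W ∧ (ρ * W).trace < 0 := by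
  let M := Matrix (Fin n₁ × Fin n₂) (Fin n₁ × Fin n₂) ℂ
  have : LocallyConvexSpace ℝ M :=
    inferInstanceAs (LocallyConvexSpace ℝ (Fin n₁ × Fin n₂ → Fin n₁ × Fin n₂ → ℂ))
  have hK : IsCompact (convexHull ℝ (productProjections n₁ n₂)) :=
    isCompact_convexHull_of_finiteDimensional isCompact_productProjections
  obtain ⟨f, u, hfρ, hfs⟩ := geometric_hahn_banach_point_closed (convex_convexHull ℝ _)
    hK.isClosed fun hmem => h (separable_of_mem_convexHull hmem)
  obtain ⟨V, hV, hVf⟩ := exists_isHermitian_trace_mul_eq f.toLinearMap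
  have htr : ∀ X : M, X.IsHermitian → X.trace = 1 →
      (X * (V - (u : ℂ) • 1)).trace = ((f X - u : ℝ) : ℂ) := by
    intro X hX hX1
    rw [mul_sub, trace_sub, hVf X hX, mul_smul_comm, trace_smul, mul_one, hX1]
    simp
  have hneg : (ρ * (V - (u : ℂ) • 1)).trace < 0 := by
    rw [htr ρ hρ.1.isHermitian hρ.2]
    exact_mod_cast sub_neg.2 hfρ
  refine ⟨V - (u : ℂ) • 1, ⟨?_, fun hpos => ?_, ?_⟩, hneg⟩
  · refine hV.sub ?_
    simp [IsHermitian, conjTranspose_smul]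
  · exact (hρ.1.trace_mul_nonneg hpos).not_gt hneg
  · refine dotProduct_mulVec_vKron_nonneg fun P hP => ?_
    have hPf := hfs P (subset_convexHull ℝ _ hP)
    obtain ⟨⟨x, y⟩, ⟨hx, hy⟩, rfl⟩ := hP
    have hx1 := isDensity_vecMulVec_star (mem_sphere_zero_iff_norm.1 hx)
    have hy1 := isDensity_vecMulVec_star (mem_sphere_zero_iff_norm.1 hy)
    rw [htr _ (posSemidef_vecMulVec_self_star _).isHermitian]
    · exact_mod_cast (sub_pos.2 hPf).le
    · dsimp only
      rw [vecMulVec_vKron_star, trace_kronecker, hx1.2, hy1.2, one_mul]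

end Bipartite

/-- entanglement witness theorem: a density matrix `ρ` is
entangled iff some entanglement witness `W` has `Tr(ρW) < 0`, and separable iff
`Tr(ρW) ≥ 0` for every entanglement witness `W`. -/
theorem stmt14 {n₁ n₂ : ℕ} (hn₁ : 1 ≤ n₁) (hn₂ : 1 ≤ n₂)
    (ρ : Matrix (Fin n₁ × Fin n₂) (Fin n₁ × Fin n₂) ℂ) (hρ : IsDensity ρ) :
    (¬Separable ρ ↔ ∃ W, IsWitness W ∧ (ρ * W).trace < 0)
    ∧ (Separable ρ ↔ ∀ W, IsWitness W → 0 ≤ (ρ * W).trace) := by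
  have hsep : Separable ρ → ∀ W, IsWitness W → 0 ≤ (ρ * W).trace :=
    fun h W hW => h.trace_mul_nonneg hW.2.2
  refine ⟨⟨exists_isWitness_of_not_separable hρ, ?_⟩, hsep, fun h => ?_⟩
  · rintro ⟨W, hW, hneg⟩ h
    exact (hsep h W hW).not_gt hneg
  · by_contra hn
    obtain ⟨W, hW, hneg⟩ := exists_isWitness_of_not_separable hρ hn
    exact (h W hW).not_gt hneg
end
end

section
/- The bivariate real polynomial m(x₁,x₂) = x₁⁴x₂² + x₁²x₂⁴ − x₁²x₂² + 1 satisfies m(x₁,x₂) ≥ 0 for all (x₁,x₂) ∈ ℝ², yet m is not a sum of squares of real polynomials: there is no finite family p₁,…,p_k ∈ ℝ[x₁,x₂] with m = Σ_{i=1}^k p_i². -/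
open MvPolynomial

noncomputable section

/-- The Motzkin polynomial `m(x₁,x₂) = x₁⁴x₂² + x₁²x₂⁴ − x₁²x₂² + 1`. -/
def motzkin : MvPolynomial (Fin 2) ℝ :=
  X 0 ^ 4 * X 1 ^ 2 + X 0 ^ 2 * X 1 ^ 4 - X 0 ^ 2 * X 1 ^ 2 + 1

/-- Over an ordered field, leading terms cannot cancel in a sum of squares: twice the total degree
of each summand is at most the total degree of the sum. -/
theorem two_mul_totalDegree_le_of_sum_sq {σ ι K : Type*} [LinearOrder σ] [WellFoundedGT σ]
    [Field K] [LinearOrder K] [IsStrictOrderedRing K] [Fintype ι]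
    (p : ι → MvPolynomial σ K) (i : ι) :
    2 * (p i).totalDegree ≤ (∑ j, p j ^ 2).totalDegree := by
  obtain ⟨j, -, hj⟩ := Finset.exists_max_image Finset.univ
    (fun j => MonomialOrder.degLex.toSyn (MonomialOrder.degLex.degree (p j))) ⟨i, Finset.mem_univ i⟩
  set d := MonomialOrder.degLex.degree (p j) with hd
  have hij : (p i).totalDegree ≤ (p j).totalDegree :=
    degLex_totalDegree_monotone (hj i (Finset.mem_univ i))
  by_cases h0 : p j = 0
  · simp_all
  have hcoeff : (∑ l, p l ^ 2).coeff (d + d) = ∑ l, (p l).coeff d ^ 2 := by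
    rw [coeff_sum]
    refine Finset.sum_congr rfl fun l hl => ?_
    rw [sq, sq, MonomialOrder.coeff_mul_of_add_of_degree_le (hj l hl) (hj l hl)]
  have hpos : 0 < ∑ l, (p l).coeff d ^ 2 := by
    refine Finset.sum_pos' (fun l _ => sq_nonneg _) ⟨j, Finset.mem_univ j, ?_⟩
    have : (p j).coeff d ≠ 0 := MonomialOrder.leadingCoeff_ne_zero_iff.mpr h0
    positivity
  have hle := le_totalDegree (mem_support_iff.mpr (hcoeff.trans_ne hpos.ne'))
  have hdeg : d.degree = (p j).totalDegree := degree_degLexDegree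
  change (d + d).degree ≤ _ at hle
  rw [map_add, hdeg] at hle
  omega

/-- The exponent of `x₁ᵃ x₂ᵇ`. -/
def bivariateExponent (a b : ℕ) : Fin 2 →₀ ℕ := Finsupp.single 0 a + Finsupp.single 1 b

@[simp]
theorem bivariateExponent_zero (a b : ℕ) : bivariateExponent a b 0 = a := by
  simp [bivariateExponent]

@[simp]
theorem bivariateExponent_one (a b : ℕ) : bivariateExponent a b 1 = b := by
  simp [bivariateExponent]

@[simp]
theorem bivariateExponent_inj {a b c d : ℕ} :
    bivariateExponent a b = bivariateExponent c d ↔ a = c ∧ b = d := by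
  simp [Finsupp.ext_iff, Fin.forall_fin_two]

theorem coeff_bivariateExponent_mul {R : Type*} [CommSemiring R] (p q : MvPolynomial (Fin 2) R)
    (a b : ℕ) :
    (p * q).coeff (bivariateExponent a b) =
      ∑ u ∈ Finset.HasAntidiagonal.antidiagonal a, ∑ v ∈
        Finset.HasAntidiagonal.antidiagonal b,
        p.coeff (bivariateExponent u.1 v.1) * q.coeff (bivariateExponent u.2 v.2) := by
  rw [coeff_mul, ← Finset.sum_product']
  refine Finset.sum_nbij' (fun e => ((e.1 0, e.2 0), (e.1 1, e.2 1)))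
    (fun w => (bivariateExponent w.1.1 w.2.1, bivariateExponent w.1.2 w.2.2)) ?_ ?_ ?_ ?_ ?_
  · rintro ⟨e, f⟩ h
    simp_all [Finsupp.ext_iff, Fin.forall_fin_two]
  · rintro ⟨⟨u, u'⟩, v, v'⟩ h
    simp_all [Finsupp.ext_iff, Fin.forall_fin_two]
  · rintro ⟨e, f⟩ h
    simp [Finsupp.ext_iff, Fin.forall_fin_two]
  · rintro ⟨⟨u, u'⟩, v, v'⟩ h
    simp
  · rintro ⟨e, f⟩ h
    congr 2 <;> simp [Finsupp.ext_iff, Fin.forall_fin_two]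

theorem coeff_motzkin (a b : ℕ) :
    motzkin.coeff (bivariateExponent a b) =
      (if 4 = a ∧ 2 = b then 1 else 0) + (if 2 = a ∧ 4 = b then 1 else 0)
        - (if 2 = a ∧ 2 = b then 1 else 0) + (if 0 = a ∧ 0 = b then 1 else 0) := by
  have h (c d : ℕ) : (X 0 ^ c * X 1 ^ d : MvPolynomial (Fin 2) ℝ) =
      monomial (bivariateExponent c d) 1 := by
    simp [X_pow_eq_monomial, monomial_mul, bivariateExponent]
  have h1 : (1 : MvPolynomial (Fin 2) ℝ) = monomial (bivariateExponent 0 0) 1 := by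
    rw [← h]; simp
  rw [motzkin, h, h, h, h1]
  simp only [coeff_add, coeff_sub, coeff_monomial, bivariateExponent_inj]

theorem totalDegree_motzkin_le : motzkin.totalDegree ≤ 6 := by
  have h (c d : ℕ) : (X 0 ^ c * X 1 ^ d : MvPolynomial (Fin 2) ℝ).totalDegree ≤ c + d :=
    (totalDegree_mul _ _).trans (by simp [totalDegree_X_pow])
  refine (totalDegree_add _ _).trans (max_le ?_ (by simp))
  refine (totalDegree_sub _ _).trans (max_le ?_ ((h 2 2).trans (by norm_num)))
  exact (totalDegree_add _ _).trans (max_le (h 4 2) (h 2 4))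

theorem motzkin_ne_sum_sq {ι : Type*} [Fintype ι] (p : ι → MvPolynomial (Fin 2) ℝ) :
    motzkin ≠ ∑ i, p i ^ 2 := by
  intro h
  have hdeg (i : ι) (a b : ℕ) (hab : 4 ≤ a + b) : (p i).coeff (bivariateExponent a b) = 0 := by
    apply coeff_eq_zero_of_totalDegree_lt
    have h1 := two_mul_totalDegree_le_of_sum_sq p i
    rw [← h] at h1
    have h2 := totalDegree_motzkin_le
    change _ < (bivariateExponent a b).degree
    simp only [bivariateExponent, map_add, Finsupp.degree_single]
    omega
  have hcoeff (a b : ℕ) := congrArg (coeff (bivariateExponent a b)) h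
  simp only [coeff_motzkin, coeff_sum, sq, coeff_bivariateExponent_mul] at hcoeff
  have sum_zero {f : ι → ℝ} (hf : 0 = ∑ i, f i * f i) (i : ι) : f i = 0 := by
    have := (Finset.sum_eq_zero_iff_of_nonneg fun j _ => mul_self_nonneg (f j)).mp hf.symm i
      (Finset.mem_univ i)
    simpa using this
  have h30 := sum_zero (f := fun i => (p i).coeff (bivariateExponent 3 0)) <| by
    simpa [Finset.Nat.antidiagonal_succ, hdeg] using hcoeff 6 0
  have h03 := sum_zero (f := fun i => (p i).coeff (bivariateExponent 0 3)) <| by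
    simpa [Finset.Nat.antidiagonal_succ, hdeg] using hcoeff 0 6
  have h20 := sum_zero (f := fun i => (p i).coeff (bivariateExponent 2 0)) <| by
    simpa [Finset.Nat.antidiagonal_succ, hdeg, h30] using hcoeff 4 0
  have h02 := sum_zero (f := fun i => (p i).coeff (bivariateExponent 0 2)) <| by
    simpa [Finset.Nat.antidiagonal_succ, hdeg, h03] using hcoeff 0 4
  have h10 := sum_zero (f := fun i => (p i).coeff (bivariateExponent 1 0)) <| by
    simpa [Finset.Nat.antidiagonal_succ, h20] using hcoeff 2 0
  have h01 := sum_zero (f := fun i => (p i).coeff (bivariateExponent 0 1)) <| by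
    simpa [Finset.Nat.antidiagonal_succ, h02] using hcoeff 0 2
  have h11 : -1 =
      ∑ i, (p i).coeff (bivariateExponent 1 1) * (p i).coeff (bivariateExponent 1 1) := by
    simpa [Finset.Nat.antidiagonal_succ, hdeg, h20, h02, h10, h01] using hcoeff 2 2
  have := Finset.sum_nonneg fun i (_ : i ∈ Finset.univ) =>
    mul_self_nonneg ((p i).coeff (bivariateExponent 1 1))
  linarith

theorem eval_motzkin_nonneg (x : Fin 2 → ℝ) : 0 ≤ eval x motzkin := by
  have key (s t : ℝ) (hs : 0 ≤ s) (ht : 0 ≤ t) : 0 ≤ s ^ 2 * t + s * t ^ 2 - s * t + 1 := by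
    rcases le_total (s + t) 1 with hst | hst
    · nlinarith [mul_nonneg hs ht, mul_nonneg (mul_nonneg hs ht) (add_nonneg hs ht),
        sq_nonneg (s - t)]
    · nlinarith [mul_nonneg (mul_nonneg hs ht) (sub_nonneg.mpr hst)]
  have := key (x 0 ^ 2) (x 1 ^ 2) (sq_nonneg _) (sq_nonneg _)
  simp only [motzkin, map_add, map_sub, map_mul, map_pow, eval_X, map_one]
  linarith

/-- the Motzkin polynomial is nonnegative on `ℝ²` but is not a sum
of squares of real polynomials. -/
theorem stmt17 :
    (∀ x : Fin 2 → ℝ, 0 ≤ MvPolynomial.eval x motzkin)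
    ∧ ¬∃ (k : ℕ) (p : Fin k → MvPolynomial (Fin 2) ℝ),
        motzkin = ∑ i, p i ^ 2 := by
  exact ⟨eval_motzkin_nonneg, fun ⟨_, p, h⟩ => motzkin_ne_sum_sq p h⟩
end
end
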